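/- Let C_1 and C_2 be cycles in the full grid graph G that have more than one vertex in common. Then there exists a unique cycle C_3 consisting only of edges of C_1 and C_2 with the following properties: (i) the interior of C_3 contains the interior of C_1 and the interior of C_2; (ii) every edge that belongs to C_1 or to C_2 either belongs to C_3 or is contained in the interior of C_3. -/

import Mathlib

/-!
Common framework: tile ℝ² into closed unit squares indexed by `ℤ²`, with corners
forming a translate of `ℤ²` and the origin the centre of the square `S₀` (index `(0,0)`).
A cycle is identified with its edge set (a set of unordered pairs of corners);
its interior (resp. exterior) is the union of the bounded (resp. unbounded)
connected components of the complement of the closed curve it traces in the plane.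
-/

/-- Corners of the grid squares, indexed by `ℤ²`. -/
abbrev GridV := ℤ × ℤ

/-- Embedding of corners into the plane: the square of index `z` is
`[z₁ - 1/2, z₁ + 1/2] × [z₂ - 1/2, z₂ + 1/2]`, so the origin is the centre of `S₀`. -/
noncomputable def toPlane (v : GridV) : ℝ × ℝ := ((v.1 : ℝ) - 1 / 2, (v.2 : ℝ) - 1 / 2)

/-- The closed unit square of index `z`. -/
def squareSet (z : GridV) : Set (ℝ × ℝ) :=
  Set.Icc ((z.1 : ℝ) - 1 / 2, (z.2 : ℝ) - 1 / 2) ((z.1 : ℝ) + 1 / 2, (z.2 : ℝ) + 1 / 2)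

/-- The four edges (unit segments) of the square of index `z`, as unordered pairs of corners. -/
def squareEdges (z : GridV) : Set (Sym2 GridV) :=
  {s(z, z + (1, 0)), s(z + (1, 0), z + (1, 1)), s(z + (1, 1), z + (0, 1)), s(z + (0, 1), z)}

/-- Adjacency of corners in the full grid graph `G`: Euclidean distance one. -/
def GridAdj (u v : GridV) : Prop := |u.1 - v.1| + |u.2 - v.2| = 1

/-- A cycle in the full grid graph: a cyclic sequence `(v₀, …, v_{n-1}, v₀)` of
distinct corners with consecutive corners adjacent. -/
structure GridCycle where
  n : ℕ
  hn : 3 ≤ n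
  f : ZMod n → GridV
  inj : Function.Injective f
  adj : ∀ i, GridAdj (f i) (f (i + 1))

/-- The edge set of a grid cycle. -/
def GridCycle.edgeSet (C : GridCycle) : Set (Sym2 GridV) :=
  {e | ∃ i : ZMod C.n, e = s(C.f i, C.f (i + 1))}

/-- An edge set is (the edge set of) a cycle of the grid graph `G`.
We identify a cycle with its edge set. -/
def IsCycle (E : Set (Sym2 GridV)) : Prop := ∃ C : GridCycle, C.edgeSet = E

/-- A cycle of the subgraph of the grid graph with edge set `G`. -/
def IsCycleIn (G E : Set (Sym2 GridV)) : Prop := IsCycle E ∧ E ⊆ G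

/-- The vertices incident to some edge of `E`. -/
def vertexSetOf (E : Set (Sym2 GridV)) : Set GridV := {v | ∃ e ∈ E, v ∈ e}

/-- The closed segment in the plane realizing an edge. -/
noncomputable def edgeSeg : Sym2 GridV → Set (ℝ × ℝ) :=
  Sym2.lift ⟨fun a b => segment ℝ (toPlane a) (toPlane b), fun _ _ => segment_symm ℝ _ _⟩

/-- The closed curve in the plane traced by the edges of `E`. -/
noncomputable def carrierOf (E : Set (Sym2 GridV)) : Set (ℝ × ℝ) := ⋃ e ∈ E, edgeSeg e

/-- The interior of a cycle: the union of the bounded connected components of the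
complement of its carrier curve. -/
noncomputable def interiorOf (E : Set (Sym2 GridV)) : Set (ℝ × ℝ) :=
  {p | p ∉ carrierOf E ∧ Bornology.IsBounded (connectedComponentIn (carrierOf E)ᶜ p)}

/-- The exterior of a cycle: the union of the unbounded connected components of the
complement of its carrier curve. -/
noncomputable def exteriorOf (E : Set (Sym2 GridV)) : Set (ℝ × ℝ) :=
  {p | p ∉ carrierOf E ∧ ¬ Bornology.IsBounded (connectedComponentIn (carrierOf E)ᶜ p)}

/-- The set `A` is contained in the interior of the cycle `E` (points of the
curve itself being allowed, so that e.g. a square whose boundary edges lie on the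
cycle counts as contained in the interior). -/
def inInterior (E : Set (Sym2 GridV)) (A : Set (ℝ × ℝ)) : Prop :=
  A ⊆ interiorOf E ∪ carrierOf E

/-- The set `A` lies in the exterior of the cycle `E` (points of the curve itself
being allowed). -/
def inExterior (E : Set (Sym2 GridV)) (A : Set (ℝ × ℝ)) : Prop :=
  A ⊆ exteriorOf E ∪ carrierOf E

/-- Star adjacency: distinct squares sharing at least a corner. -/
def starAdj (z w : GridV) : Prop := z ≠ w ∧ |z.1 - w.1| ≤ 1 ∧ |z.2 - w.2| ≤ 1

/-- Plus adjacency: squares sharing an edge. -/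
def plusAdj (z w : GridV) : Prop := |z.1 - w.1| + |z.2 - w.2| = 1

/-- The star-connected occupied component `C(0)` of the square `S₀` (of index `(0,0)`),
for the occupancy configuration `ω`; empty if `S₀` is vacant. -/
def starComp (ω : GridV → Prop) : Set GridV :=
  {z | ω z ∧ Relation.ReflTransGen (fun a b => ω a ∧ ω b ∧ starAdj a b) (0, 0) z}

/-- The plus-connected occupied component `C⁺(0)` of the square `S₀`. -/
def plusComp (ω : GridV → Prop) : Set GridV :=
  {z | ω z ∧ Relation.ReflTransGen (fun a b => ω a ∧ ω b ∧ plusAdj a b) (0, 0) z}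

/-- The edge set of the graph `G_C`: all edges of squares of `C(0)`. -/
def gcEdges (ω : GridV → Prop) : Set (Sym2 GridV) := ⋃ z ∈ starComp ω, squareEdges z

/-- The edge set of the graph `G⁺_C`: all edges of squares of `C⁺(0)`. -/
def gpcEdges (ω : GridV → Prop) : Set (Sym2 GridV) := ⋃ z ∈ plusComp ω, squareEdges z

/-- `e` is an outermost boundary edge of the graph with edge set `G`: for every
cycle `E` in this graph, either `e` is an edge of `E` or `e` lies in the exterior of `E`. -/
def outermostBoundaryEdgeIn (G : Set (Sym2 GridV)) (e : Sym2 GridV) : Prop :=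
  e ∈ G ∧ ∀ E, IsCycleIn G E → e ∈ E ∨ inExterior E (edgeSeg e)

/-- The subgraph spanned by the edge set `E` is connected: any two incident vertices
are joined by a walk using only edges of `E`. -/
def EdgeSetConnected (E : Set (Sym2 GridV)) : Prop :=
  ∀ u v, u ∈ vertexSetOf E → v ∈ vertexSetOf E →
    ∃ p : List GridV, p.head? = some u ∧ p.getLast? = some v ∧
      List.Chain' (fun a b => s(a, b) ∈ E) p

/-- `D` is the outermost boundary cycle `D_k` of the square of index `z` of the star
component `C(0)`: (a) the square lies in the interior of `D`; (b) every edge of `D` is a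
boundary edge adjacent to an occupied square of `C(0)` in the interior of `D` and to a
vacant square in the exterior of `D`; (c) every cycle of `G_C` containing the square in
its interior has all its edges on `D` or in the interior of `D`. -/
def isOutermostCycleOf (ω : GridV → Prop) (z : GridV) (D : Set (Sym2 GridV)) : Prop :=
  IsCycleIn (gcEdges ω) D ∧
  inInterior D (squareSet z) ∧
  (∀ e ∈ D,
    (∃ w ∈ starComp ω, e ∈ squareEdges w ∧ inInterior D (squareSet w)) ∧
    (∃ w, ¬ ω w ∧ e ∈ squareEdges w ∧ inExterior D (squareSet w))) ∧
  (∀ C, IsCycleIn (gcEdges ω) C → inInterior C (squareSet z) →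
    ∀ e ∈ C, e ∈ D ∨ inInterior D (edgeSeg e))

/-- The list of edges traversed by a walk given as a list of vertices. -/
def walkEdges (p : List GridV) : List (Sym2 GridV) :=
  List.zipWith (fun a b => s(a, b)) p p.tail

open scoped Classical in
/-- The indicator function of a set, with values in `ZMod 2`. -/
noncomputable def chi {α : Type*} (E : Set α) (e : α) : ZMod 2 := if e ∈ E then 1 else 0

/-- The horizontal edge whose left endpoint is `(x, y)`. -/
def hEdge (x y : ℤ) : Sym2 GridV := s((x, y), (x + 1, y))

/-- The vertical edge whose lower endpoint is `(x, y)`. -/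
def vEdge (x y : ℤ) : Sym2 GridV := s((x, y), (x, y + 1))

/-- `e` is an edge of the full grid graph. -/
def IsGridEdge (e : Sym2 GridV) : Prop := ∃ x y, e = hEdge x y ∨ e = vEdge x y

/-- The edge `e` is the common side of the squares of index `z` and `w`. -/
inductive Separates : Sym2 GridV → GridV → GridV → Prop
  | down (x y : ℤ) : Separates (hEdge x y) (x, y) (x, y - 1)
  | up (x y : ℤ) : Separates (hEdge x y) (x, y - 1) (x, y)
  | left (x y : ℤ) : Separates (vEdge x y) (x, y) (x - 1, y)
  | right (x y : ℤ) : Separates (vEdge x y) (x - 1, y) (x, y)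

/-- The edges separating a square of `L` from a square outside `L`. -/
def cellBoundary (L : Set GridV) : Set (Sym2 GridV) :=
  {e | ∃ z ∈ L, ∃ w ∉ L, Separates e z w}

/-- The degree modulo two of the vertex `(x, y)` in the chain `c`. -/
def chainDeg (c : Sym2 GridV → ZMod 2) (v : GridV) : ZMod 2 :=
  c (hEdge v.1 v.2) + c (hEdge (v.1 - 1) v.2) + c (vEdge v.1 v.2) + c (vEdge v.1 (v.2 - 1))

/-- A finite set of grid edges in which every vertex has even degree. -/
structure IsEven (E : Set (Sym2 GridV)) : Prop where
  finite : E.Finite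
  grid : ∀ e ∈ E, IsGridEdge e
  deg : ∀ v, chainDeg (chi E) v = 0

theorem chi_of_mem {α : Type*} {E : Set α} {e : α} (h : e ∈ E) : chi E e = 1 := if_pos h

theorem chi_of_notMem {α : Type*} {E : Set α} {e : α} (h : e ∉ E) : chi E e = 0 := if_neg h

theorem chi_eq_one_iff {α : Type*} {E : Set α} {e : α} : chi E e = 1 ↔ e ∈ E := by
  by_cases h : e ∈ E <;> simp [chi, h]

theorem hEdge_inj {x y x' y' : ℤ} : hEdge x y = hEdge x' y' ↔ x = x' ∧ y = y' := by
  simp only [hEdge, Sym2.eq_iff, Prod.mk.injEq]; omega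

theorem vEdge_inj {x y x' y' : ℤ} : vEdge x y = vEdge x' y' ↔ x = x' ∧ y = y' := by
  simp only [vEdge, Sym2.eq_iff, Prod.mk.injEq]; omega

theorem hEdge_ne_vEdge {x y x' y' : ℤ} : hEdge x y ≠ vEdge x' y' := by
  simp only [hEdge, vEdge, ne_eq, Sym2.eq_iff, Prod.mk.injEq]; omega

theorem GridAdj.eq_edge {a b : GridV} (h : GridAdj a b) :
    s(a, b) = hEdge a.1 a.2 ∧ b = (a.1 + 1, a.2) ∨ s(a, b) = hEdge b.1 b.2 ∧ a = (b.1 + 1, b.2) ∨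
    s(a, b) = vEdge a.1 a.2 ∧ b = (a.1, a.2 + 1) ∨
      s(a, b) = vEdge b.1 b.2 ∧ a = (b.1, b.2 + 1) := by
  obtain ⟨a1, a2⟩ := a
  obtain ⟨b1, b2⟩ := b
  have h' : (b1 = a1 + 1 ∧ b2 = a2) ∨ (a1 = b1 + 1 ∧ a2 = b2) ∨ (b1 = a1 ∧ b2 = a2 + 1) ∨
      (a1 = b1 ∧ a2 = b2 + 1) := by
    simp only [GridAdj] at h
    rcases abs_cases (a1 - b1) with ⟨h1, _⟩ | ⟨h1, _⟩ <;>
    rcases abs_cases (a2 - b2) with ⟨h2, _⟩ | ⟨h2, _⟩ <;> omega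
  rcases h' with ⟨rfl, rfl⟩ | ⟨rfl, rfl⟩ | ⟨rfl, rfl⟩ | ⟨rfl, rfl⟩
  · exact .inl ⟨rfl, rfl⟩
  · exact .inr (.inl ⟨Sym2.eq_swap, rfl⟩)
  · exact .inr (.inr (.inl ⟨rfl, rfl⟩))
  · exact .inr (.inr (.inr ⟨Sym2.eq_swap, rfl⟩))

theorem GridAdj.isGridEdge {a b : GridV} (h : GridAdj a b) : IsGridEdge s(a, b) := by
  rcases h.eq_edge with ⟨h, -⟩ | ⟨h, -⟩ | ⟨h, -⟩ | ⟨h, -⟩ <;> rw [h]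
  exacts [⟨_, _, .inl rfl⟩, ⟨_, _, .inl rfl⟩, ⟨_, _, .inr rfl⟩, ⟨_, _, .inr rfl⟩]

theorem IsGridEdge.gridAdj {a b : GridV} (h : IsGridEdge s(a, b)) : GridAdj a b := by
  obtain ⟨x, y, h | h⟩ := h <;> simp only [hEdge, vEdge, Sym2.eq_iff] at h <;>
    rcases h with ⟨rfl, rfl⟩ | ⟨rfl, rfl⟩ <;> simp [GridAdj]

theorem chainDeg_single {a b : GridV} (h : GridAdj a b) (v : GridV) :
    chainDeg (chi {s(a, b)}) v = chi {a} v + chi {b} v := by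
  obtain ⟨a1, a2⟩ := a
  obtain ⟨b1, b2⟩ := b
  obtain ⟨v1, v2⟩ := v
  rcases h.eq_edge with ⟨he, hb⟩ | ⟨he, hb⟩ | ⟨he, hb⟩ | ⟨he, hb⟩ <;>
  · rw [he]
    simp only [Prod.mk.injEq] at hb
    obtain ⟨rfl, rfl⟩ := hb
    simp only [chainDeg, chi, Set.mem_singleton_iff, hEdge_inj, vEdge_inj, hEdge_ne_vEdge,
      hEdge_ne_vEdge.symm, if_false, Prod.mk.injEq, add_zero, zero_add, sub_eq_iff_eq_add]
    try exact add_comm _ _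

theorem chainDeg_add (c d : Sym2 GridV → ZMod 2) (v : GridV) :
    chainDeg (c + d) v = chainDeg c v + chainDeg d v := by
  simp only [chainDeg, Pi.add_apply]; ring

theorem chainDeg_sum {ι : Type*} (s : Finset ι) (k : ι → ZMod 2) (c : ι → Sym2 GridV → ZMod 2)
    (v : GridV) :
    chainDeg (fun e => ∑ i ∈ s, k i * c i e) v = ∑ i ∈ s, k i * chainDeg (c i) v := by
  simp only [chainDeg, mul_add, Finset.sum_add_distrib]

theorem Separates.symm {e : Sym2 GridV} {z w : GridV} (h : Separates e z w) :
    Separates e w z := by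
  cases h <;> constructor

theorem IsGridEdge.exists_separates {e : Sym2 GridV} (h : IsGridEdge e) :
    ∃ z w, Separates e z w := by
  obtain ⟨x, y, rfl | rfl⟩ := h
  · exact ⟨_, _, .down x y⟩
  · exact ⟨_, _, .left x y⟩

theorem Separates.isGridEdge {e : Sym2 GridV} {z w : GridV} (h : Separates e z w) :
    IsGridEdge e := by
  cases h
  exacts [⟨_, _, .inl rfl⟩, ⟨_, _, .inl rfl⟩, ⟨_, _, .inr rfl⟩, ⟨_, _, .inr rfl⟩]

theorem Separates.unique {e : Sym2 GridV} {z w z' w' : GridV} (h : Separates e z w)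
    (h' : Separates e z' w') : z = z' ∧ w = w' ∨ z = w' ∧ w = z' := by
  generalize he : e = e' at h'
  cases h <;> cases h' <;> simp_all [hEdge_inj, vEdge_inj, hEdge_ne_vEdge, hEdge_ne_vEdge.symm]

theorem Separates.mem_cellBoundary_iff {e : Sym2 GridV} {z w : GridV} (h : Separates e z w)
    {L : Set GridV} : e ∈ cellBoundary L ↔ ¬ (z ∈ L ↔ w ∈ L) := by
  constructor
  · rintro ⟨z', hz', w', hw', h'⟩
    rcases h.unique h' with ⟨rfl, rfl⟩ | ⟨rfl, rfl⟩ <;> tauto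
  · intro hn
    by_cases hz : z ∈ L
    · exact ⟨z, hz, w, by tauto, h⟩
    · exact ⟨w, by tauto, z, hz, h.symm⟩

theorem cellBoundary_isGridEdge {L : Set GridV} {e : Sym2 GridV} (h : e ∈ cellBoundary L) :
    IsGridEdge e := by
  obtain ⟨_, _, _, _, h⟩ := h
  exact h.isGridEdge

theorem cellBoundary_empty : cellBoundary ∅ = ∅ := by
  ext e; simp [cellBoundary]

theorem exists_vEdge_right {L : Set GridV} (hL : L.Finite) {x y : ℤ} (h : (x, y) ∈ L) :
    ∃ j > x, vEdge j y ∈ cellBoundary L := by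
  by_contra! hcon
  have key : ∀ k : ℕ, (x + k, y) ∈ L := by
    intro k
    induction k with
    | zero => simpa using h
    | succ k ih =>
      have := hcon (x + k + 1) (by omega)
      rw [(Separates.left _ _).mem_cellBoundary_iff] at this
      push_cast
      rw [← add_assoc]
      have e : x + (k : ℤ) + 1 - 1 = x + k := by ring
      rw [e] at this
      tauto
  exact Set.infinite_of_injective_forall_mem (f := fun k : ℕ => ((x + k, y) : GridV))
    (fun a b hab => by simpa using hab) key hL

theorem exists_vEdge_left {L : Set GridV} (hL : L.Finite) {x y : ℤ} (h : (x, y) ∈ L) :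
    ∃ j ≤ x, vEdge j y ∈ cellBoundary L := by
  by_contra! hcon
  have key : ∀ k : ℕ, (x - k, y) ∈ L := by
    intro k
    induction k with
    | zero => simpa using h
    | succ k ih =>
      have := hcon (x - k) (by omega)
      rw [(Separates.left _ _).mem_cellBoundary_iff] at this
      push_cast
      rw [← sub_sub]
      tauto
  exact Set.infinite_of_injective_forall_mem (f := fun k : ℕ => ((x - k, y) : GridV))
    (fun a b hab => by simpa using hab) key hL

theorem eq_empty_of_cellBoundary_eq_empty {L : Set GridV} (hL : L.Finite)
    (h : cellBoundary L = ∅) : L = ∅ := by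
  by_contra hne
  obtain ⟨⟨x, y⟩, hz⟩ := Set.nonempty_iff_ne_empty.2 hne
  obtain ⟨j, -, hj⟩ := exists_vEdge_right hL hz
  simp [h] at hj

theorem cellBoundary_injOn {L M : Set GridV} (hL : L.Finite) (hM : M.Finite)
    (h : cellBoundary L = cellBoundary M) : L = M := by
  have h0 : symmDiff L M = ∅ := by
    apply eq_empty_of_cellBoundary_eq_empty
    · exact (hL.union hM).subset Set.symmDiff_subset_union
    · refine Set.eq_empty_of_forall_notMem fun e he => ?_
      obtain ⟨z, w, hs⟩ := (cellBoundary_isGridEdge he).exists_separates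
      have h1 : e ∈ cellBoundary L ↔ e ∈ cellBoundary M := by rw [h]
      rw [hs.mem_cellBoundary_iff] at he h1
      rw [hs.mem_cellBoundary_iff] at h1
      simp only [Set.mem_symmDiff] at he
      tauto
  exact symmDiff_eq_bot.1 h0

theorem exists_bounds {G : Set (Sym2 GridV)} (hG : G.Finite) :
    ∃ a b : GridV, ∀ x y, hEdge x y ∈ G ∨ vEdge x y ∈ G → a ≤ (x, y) ∧ (x, y) ≤ b := by
  have hfin : {z : GridV | hEdge z.1 z.2 ∈ G ∨ vEdge z.1 z.2 ∈ G}.Finite := by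
    apply Set.Finite.union
    · exact hG.preimage (f := fun z : GridV => hEdge z.1 z.2)
        (fun z _ w _ h => Prod.ext_iff.2 (hEdge_inj.1 h))
    · exact hG.preimage (f := fun z : GridV => vEdge z.1 z.2)
        (fun z _ w _ h => Prod.ext_iff.2 (vEdge_inj.1 h))
  obtain ⟨a, ha⟩ := hfin.bddBelow
  obtain ⟨b, hb⟩ := hfin.bddAbove
  exact ⟨a, b, fun x y h => ⟨ha (a := (x, y)) h, hb (a := (x, y)) h⟩⟩

theorem finite_cellBoundary {L : Set GridV} (hL : L.Finite) : (cellBoundary L).Finite := by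
  have : cellBoundary L ⊆ (⋃ z ∈ L, {hEdge z.1 z.2, hEdge z.1 (z.2 + 1), vEdge z.1 z.2,
      vEdge (z.1 + 1) z.2}) := by
    rintro e ⟨z, hz, w, -, hs⟩
    refine Set.mem_biUnion hz ?_
    cases hs <;> simp
  exact (hL.biUnion fun z _ => by simp).subset this

theorem chi_cellBoundary {L : Set GridV} {e : Sym2 GridV} {z w : GridV} (h : Separates e z w) :
    chi (cellBoundary L) e = chi L z + chi L w := by
  have := h.mem_cellBoundary_iff (L := L)
  by_cases hz : z ∈ L <;> by_cases hw : w ∈ L <;> simp [chi, this, hz, hw]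
  rfl

theorem isEven_cellBoundary {L : Set GridV} (hL : L.Finite) : IsEven (cellBoundary L) where
  finite := finite_cellBoundary hL
  grid _ := cellBoundary_isGridEdge
  deg := by
    rintro ⟨x, y⟩
    simp only [chainDeg]
    rw [chi_cellBoundary (.down _ _), chi_cellBoundary (.down _ _), chi_cellBoundary (.left _ _),
      chi_cellBoundary (.left _ _)]
    generalize chi L _ = a
    generalize chi L _ = b
    generalize chi L _ = c
    generalize chi L _ = d
    revert a b c d
    decide

theorem IsEven.exists_cellBoundary {E : Set (Sym2 GridV)} (hE : IsEven E) :
    ∃ L : Set GridV, L.Finite ∧ cellBoundary L = E := by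
  obtain ⟨⟨a1, a2⟩, ⟨b1, b2⟩, hab⟩ := exists_bounds hE.finite
  have hv : ∀ x y, ¬ (a1 ≤ x ∧ a2 ≤ y ∧ x ≤ b1 ∧ y ≤ b2) → chi E (vEdge x y) = 0 := by
    intro x y hn
    refine chi_of_notMem fun h => hn ?_
    have := hab x y (.inr h)
    simp only [Prod.mk_le_mk] at this
    tauto
  have hh : ∀ x y, ¬ (a1 ≤ x ∧ a2 ≤ y ∧ x ≤ b1 ∧ y ≤ b2) → chi E (hEdge x y) = 0 := by
    intro x y hn
    refine chi_of_notMem fun h => hn ?_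
    have := hab x y (.inl h)
    simp only [Prod.mk_le_mk] at this
    tauto
  set g : ℤ → ℤ → ZMod 2 := fun x y => ∑ i ∈ Finset.Icc a1 x, chi E (vEdge i y) with hg
  have g0 : ∀ x y, x < a1 → g x y = 0 := by
    intro x y hx
    simp [hg, Finset.Icc_eq_empty_of_lt hx]
  have gx : ∀ x y, g x y = g (x - 1) y + chi E (vEdge x y) := by
    intro x y
    by_cases hx : x < a1
    · rw [g0 x y hx, g0 _ y (by omega), hv x y (by omega), add_zero]
    · simp only [hg]
      rw [show Finset.Icc a1 x = insert x (Finset.Icc a1 (x - 1)) by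
        ext i; simp only [Finset.mem_Icc, Finset.mem_insert]; omega]
      rw [Finset.sum_insert (by simp), add_comm]
  have gy' : ∀ y (k : ℕ), g (a1 - 1 + k) y + g (a1 - 1 + k) (y - 1) +
      chi E (hEdge (a1 - 1 + k) y) = 0 := by
    intro y k
    induction k with
    | zero => simp [g0 (a1 - 1) _ (by omega), hh (a1 - 1) y (by omega)]
    | succ k ih =>
      have hd := hE.deg (a1 - 1 + (k + 1 : ℕ), y)
      simp only [chainDeg] at hd
      rw [gx, gx _ (y - 1)]
      have e : a1 - 1 + ((k + 1 : ℕ) : ℤ) - 1 = a1 - 1 + k := by push_cast; ring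
      rw [e] at hd ⊢
      revert ih hd
      generalize chi E _ = t1
      generalize chi E _ = t2
      generalize chi E _ = t3
      generalize chi E _ = t4
      generalize g _ _ = t5
      generalize g _ _ = t6
      revert t1 t2 t3 t4 t5 t6
      decide
  have gy : ∀ x y, g x y = g x (y - 1) + chi E (hEdge x y) := by
    intro x y
    by_cases hx : x < a1
    · rw [g0 x y hx, g0 _ _ hx, hh x y (by omega), add_zero]
    · have := gy' y (x - (a1 - 1)).toNat
      rw [show a1 - 1 + ((x - (a1 - 1)).toNat : ℤ) = x by omega] at this
      revert this
      generalize chi E _ = t1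
      generalize g _ _ = t5
      generalize g _ _ = t6
      revert t1 t5 t6
      decide
  have gb : ∀ x y, y < a2 ∨ b2 < y → g x y = 0 := by
    intro x y hy
    exact Finset.sum_eq_zero fun i _ => hv i y (by omega)
  have gr : ∀ x, b1 < x → ∀ k : ℕ, g x (a2 - 1 + k) = 0 := by
    intro x hx k
    induction k with
    | zero => exact gb _ _ (by simp)
    | succ k ih =>
      rw [gy, hh _ _ (by omega), add_zero, ← ih]
      congr 1
      push_cast
      ring
  refine ⟨{z | g z.1 z.2 = 1}, ?_, ?_⟩
  · refine (Set.finite_Icc ((a1, a2) : GridV) (b1, b2)).subset ?_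
    rintro ⟨x, y⟩ hz
    simp only [Set.mem_ofPred_eq] at hz
    by_contra hn
    have : g x y = 0 := by
      simp only [Set.mem_Icc, Prod.mk_le_mk] at hn
      by_cases h1 : x < a1
      · exact g0 _ _ h1
      by_cases h2 : y < a2 ∨ b2 < y
      · exact gb _ _ h2
      have := gr x (by omega) (y - (a2 - 1)).toNat
      rwa [show a2 - 1 + ((y - (a2 - 1)).toNat : ℤ) = y by omega] at this
    rw [this] at hz
    exact absurd hz (by decide)
  · have key : ∀ p q r : ZMod 2, p = q + r → (¬ (p = 1 ↔ q = 1) ↔ r = 1) := by decide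
    ext e
    constructor
    · intro he
      obtain ⟨x, y, rfl | rfl⟩ := cellBoundary_isGridEdge he
      · rw [(Separates.down x y).mem_cellBoundary_iff] at he
        exact chi_eq_one_iff.1 ((key _ _ _ (gy x y)).1 he)
      · rw [(Separates.left x y).mem_cellBoundary_iff] at he
        exact chi_eq_one_iff.1 ((key _ _ _ (gx x y)).1 he)
    · intro he
      obtain ⟨x, y, rfl | rfl⟩ := hE.grid _ he
      · rw [(Separates.down x y).mem_cellBoundary_iff]
        exact (key _ _ _ (gy x y)).2 (chi_eq_one_iff.2 he)
      · rw [(Separates.left x y).mem_cellBoundary_iff]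
        exact (key _ _ _ (gx x y)).2 (chi_eq_one_iff.2 he)

namespace GridCycle

variable (C : GridCycle)

/-- The edge from the `i`-th vertex to the next one. -/
def edge (i : ZMod C.n) : Sym2 GridV := s(C.f i, C.f (i + 1))

theorem edgeSet_eq_range : C.edgeSet = Set.range C.edge := by
  ext e; simp [edgeSet, edge, eq_comm]

theorem neZero : NeZero C.n := ⟨by have := C.hn; omega⟩

theorem edge_injective : Function.Injective C.edge := by
  intro i j h
  rcases Sym2.eq_iff.1 h with ⟨h1, -⟩ | ⟨h1, h2⟩
  · exact C.inj h1
  · have h1 := C.inj h1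
    have h2 := C.inj h2
    exfalso
    have h3 : ((2 : ℕ) : ZMod C.n) = 0 := by
      rw [h1, add_assoc] at h2
      push_cast
      rw [← one_add_one_eq_two]
      exact left_eq_add.1 h2.symm
    have := Nat.le_of_dvd (by norm_num) ((ZMod.natCast_eq_zero_iff 2 C.n).1 h3)
    have := C.hn
    omega

end GridCycle

theorem chi_image {ι α : Type*} (s : Finset ι) (g : ι → α) (hg : Set.InjOn g s) (e : α) :
    chi (g '' s) e = ∑ i ∈ s, chi {g i} e := by
  classical
  by_cases h : e ∈ g '' s
  · obtain ⟨i, hi, rfl⟩ := h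
    rw [chi_of_mem (Set.mem_image_of_mem g hi), Finset.sum_eq_single_of_mem i hi,
      chi_of_mem (Set.mem_singleton _)]
    intro j hj hji
    exact chi_of_notMem fun h => hji (hg hj hi h.symm)
  · rw [chi_of_notMem h, Finset.sum_eq_zero]
    exact fun i hi => chi_of_notMem fun h' => h ⟨i, hi, h'.symm⟩

namespace GridCycle

variable (C : GridCycle)

theorem isEven_edgeSet : IsEven C.edgeSet where
  finite := by
    have := C.neZero
    rw [edgeSet_eq_range]
    exact Set.finite_range _
  grid := by
    rintro e ⟨i, rfl⟩
    exact (C.adj i).isGridEdge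
  deg v := by
    have := C.neZero
    have h : chi C.edgeSet = fun e => ∑ i, 1 * chi {C.edge i} e := by
      funext e
      rw [edgeSet_eq_range, ← Set.image_univ, ← Finset.coe_univ,
        chi_image _ _ C.edge_injective.injOn]
      simp
    rw [h, chainDeg_sum]
    simp only [edge, chainDeg_single (C.adj _), one_mul, Finset.sum_add_distrib]
    have hshift : ∑ i, chi {C.f (i + 1)} v = ∑ i, chi {C.f i} v :=
      Equiv.sum_comp (Equiv.addRight (1 : ZMod C.n)) fun i => chi {C.f i} v
    rw [hshift]
    exact CharTwo.add_self_eq_zero _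

theorem eq_edgeSet_of_isEven {E : Set (Sym2 GridV)} (hE : IsEven E) (hne : E.Nonempty)
    (hsub : E ⊆ C.edgeSet) : E = C.edgeSet := by
  have := C.neZero
  have h : chi E = fun e => ∑ i, chi E (C.edge i) * chi {C.edge i} e := by
    funext e
    by_cases he : e ∈ E
    · obtain ⟨i, rfl⟩ := C.edgeSet_eq_range ▸ hsub he
      rw [Finset.sum_eq_single_of_mem i (Finset.mem_univ _), chi_of_mem (E := {_}) rfl, mul_one]
      intro j _ hji
      rw [chi_of_notMem (E := {_}) fun h => hji (C.edge_injective h.symm), mul_zero]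
    · rw [chi_of_notMem he, Finset.sum_eq_zero]
      intro i _
      by_cases hi : e = C.edge i
      · rw [← hi, chi_of_notMem he, zero_mul]
      · rw [chi_of_notMem (E := {_}) hi, mul_zero]
  have step : ∀ j, chi E (C.edge j) = chi E (C.edge (j + 1)) := by
    intro j
    have hd := hE.deg (C.f (j + 1))
    rw [h, chainDeg_sum] at hd
    simp only [edge, chainDeg_single (C.adj _), mul_add, Finset.sum_add_distrib] at hd
    rw [Finset.sum_eq_single_of_mem (j + 1) (Finset.mem_univ _),
      Finset.sum_eq_single_of_mem j (Finset.mem_univ _)] at hd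
    · rw [chi_of_mem (E := {_}) rfl, mul_one, mul_one] at hd
      exact (CharTwo.add_eq_zero.1 hd).symm
    · intro i _ hij
      rw [chi_of_notMem (E := {_}) fun h => hij (add_right_cancel (C.inj h)).symm, mul_zero]
    · intro i _ hij
      rw [chi_of_notMem (E := {_}) fun h => hij (C.inj h).symm, mul_zero]
  have const : ∀ (k : ℕ) j, chi E (C.edge j) = chi E (C.edge (j + k)) := by
    intro k
    induction k with
    | zero => simp
    | succ k ih =>
      intro j
      rw [ih, step]
      push_cast
      rw [add_assoc]
  refine hsub.antisymm ?_
  rw [edgeSet_eq_range]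
  rintro _ ⟨i, rfl⟩
  obtain ⟨e, he⟩ := hne
  obtain ⟨j, rfl⟩ := C.edgeSet_eq_range ▸ hsub he
  rw [← chi_eq_one_iff, const (j - i).val i, ZMod.natCast_zmod_val, add_sub_cancel]
  exact chi_of_mem he

theorem nonempty_edgeSet : C.edgeSet.Nonempty := ⟨_, 0, rfl⟩

theorem mem_vertexSetOf {v : GridV} : v ∈ vertexSetOf C.edgeSet ↔ ∃ i, C.f i = v := by
  constructor
  · rintro ⟨e, ⟨i, rfl⟩, hv⟩
    rcases Sym2.mem_iff.1 hv with rfl | rfl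
    exacts [⟨_, rfl⟩, ⟨_, rfl⟩]
  · rintro ⟨i, rfl⟩
    exact ⟨_, ⟨i, rfl⟩, Sym2.mem_mk_left _ _⟩

theorem exists_arc {u v : GridV} (hu : u ∈ vertexSetOf C.edgeSet)
    (hv : v ∈ vertexSetOf C.edgeSet) :
    ∃ A ⊆ C.edgeSet, ∀ w, chainDeg (chi A) w = chi {u} w + chi {v} w := by
  have := C.neZero
  obtain ⟨a, rfl⟩ := C.mem_vertexSetOf.1 hu
  obtain ⟨b, rfl⟩ := C.mem_vertexSetOf.1 hv
  have hk : (b - a).val < C.n := ZMod.val_lt _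
  refine ⟨(fun i : ℕ => C.edge (a + i)) '' (Finset.range (b - a).val), ?_, fun w => ?_⟩
  · rw [edgeSet_eq_range]
    rintro _ ⟨i, -, rfl⟩
    exact ⟨_, rfl⟩
  · have hinj : Set.InjOn (fun i : ℕ => C.edge (a + i)) (Finset.range (b - a).val) := by
      intro i hi j hj hij
      have hij := add_left_cancel (C.edge_injective hij)
      simp only [Finset.coe_range, Set.mem_Iio] at hi hj
      have := congrArg ZMod.val hij
      rwa [ZMod.val_natCast_of_lt (by omega), ZMod.val_natCast_of_lt (by omega)] at this
    have h : chi ((fun i : ℕ => C.edge (a + i)) '' (Finset.range (b - a).val)) =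
        fun e => ∑ i ∈ Finset.range (b - a).val, 1 * chi {C.edge (a + i)} e := by
      funext e
      rw [chi_image _ _ hinj]
      simp
    rw [h, chainDeg_sum]
    have tel : ∀ k : ℕ, ∑ i ∈ Finset.range k, 1 * chainDeg (chi {C.edge (a + (i : ℕ))}) w =
        chi {C.f a} w + chi {C.f (a + k)} w := by
      intro k
      induction k with
      | zero => simp [CharTwo.add_self_eq_zero]
      | succ k ih =>
        rw [Finset.sum_range_succ, ih, edge, chainDeg_single (C.adj _), one_mul, ← add_assoc,
          add_assoc (chi {C.f a} w), CharTwo.add_self_eq_zero, add_zero]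
        push_cast
        rw [add_assoc]
    rw [tel, ZMod.natCast_zmod_val, add_sub_cancel]

end GridCycle

theorem IsEven.exists_ne_edge {E : Set (Sym2 GridV)} (hE : IsEven E) {w b : GridV}
    (h : s(b, w) ∈ E) : ∃ b', b' ≠ b ∧ s(w, b') ∈ E := by
  by_contra! hcon
  have hd := hE.deg w
  have key : ∀ b', chi E s(w, b') = chi {b} b' := by
    intro b'
    by_cases hb : b' = b
    · rw [hb, chi_of_mem (E := {_}) rfl, chi_of_mem (Sym2.eq_swap ▸ h)]
    · rw [chi_of_notMem (hcon b' hb), chi_of_notMem (E := {_}) hb]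
  obtain ⟨x, y⟩ := w
  have hadj := (hE.grid _ h).gridAdj.eq_edge
  simp only [chainDeg] at hd
  have e1 : hEdge x y = s((x, y), (x + 1, y)) := rfl
  have e2 : hEdge (x - 1) y = s((x, y), (x - 1, y)) := by
    rw [Sym2.eq_swap]; simp [hEdge]
  have e3 : vEdge x y = s((x, y), (x, y + 1)) := rfl
  have e4 : vEdge x (y - 1) = s((x, y), (x, y - 1)) := by
    rw [Sym2.eq_swap]; simp [vEdge]
  rw [e1, e2, e3, e4, key, key, key, key] at hd
  obtain ⟨b1, b2⟩ := b
  simp only [Prod.mk.injEq] at hadj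
  simp only [chi, Set.mem_singleton_iff, Prod.mk.injEq] at hd
  rcases hadj with ⟨-, rfl, rfl⟩ | ⟨-, rfl, rfl⟩ | ⟨-, rfl, rfl⟩ | ⟨-, rfl, rfl⟩ <;>
    split_ifs at hd <;> first | omega | exact absurd hd (by decide)

theorem IsEven.exists_gridCycle {E : Set (Sym2 GridV)} (hE : IsEven E) (hne : E.Nonempty) :
    ∃ C : GridCycle, C.edgeSet ⊆ E := by
  classical
  choose! next hnext using fun (p : GridV × GridV) (h : s(p.1, p.2) ∈ E) => hE.exists_ne_edge h
  obtain ⟨e, he⟩ := hne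
  induction e using Sym2.ind with | _ a b
  set st : ℕ → GridV × GridV := fun k => (fun p : GridV × GridV => (p.2, next p))^[k] (a, b)
    with hst
  have hs : ∀ k, st (k + 1) = ((st k).2, next (st k)) := fun k =>
    Function.iterate_succ_apply' _ _ _
  have hmem : ∀ k, s((st k).1, (st k).2) ∈ E := by
    intro k
    induction k with
    | zero => exact he
    | succ k ih => rw [hs]; exact (hnext _ ih).2
  set g : ℕ → GridV := fun k => (st k).1 with hg
  have hg1 : ∀ k, (st k).2 = g (k + 1) := fun k => by simp only [hg, hs]
  have hE' : ∀ k, s(g k, g (k + 1)) ∈ E := fun k => by rw [← hg1]; exact hmem k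
  have hnb : ∀ k, g (k + 2) ≠ g k := by
    intro k
    rw [← hg1, hs]
    exact (hnext _ (hmem k)).1
  have hadj : ∀ k, GridAdj (g k) (g (k + 1)) := fun k => (hE.grid _ (hE' k)).gridAdj
  have hne1 : ∀ k, g (k + 1) ≠ g k := by
    intro k h
    have := hadj k
    simp [GridAdj, h] at this
  have hfin : (vertexSetOf E).Finite := by
    have : vertexSetOf E = ⋃ e ∈ E, {v | v ∈ e} := by
      ext v; simp [vertexSetOf]
    rw [this]
    refine hE.finite.biUnion fun e _ => ?_
    induction e using Sym2.ind with | _ a b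
    simp only [Sym2.mem_iff]
    exact Set.toFinite {a, b}
  have hrep : ∃ j, ∃ i < j, g i = g j := by
    by_contra! hcon
    refine Set.infinite_of_injective_forall_mem (f := g) (s := vertexSetOf E) ?_
      (fun k => ⟨_, hE' k, Sym2.mem_mk_left _ _⟩) hfin
    intro i j hij
    rcases lt_trichotomy i j with h | h | h
    · exact absurd hij (hcon j i h)
    · exact h
    · exact absurd hij.symm (hcon i j h)
  obtain ⟨i, hij, hgij⟩ := Nat.find_spec hrep
  set j := Nat.find hrep with hj
  have hmin : ∀ m < j, ∀ l < m, g l ≠ g m := fun m hm l hl h => Nat.find_min hrep hm ⟨l, hl, h⟩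
  obtain ⟨n, hn⟩ : ∃ n, j = i + n := ⟨j - i, by omega⟩
  have hn3 : 3 ≤ n := by
    by_contra hlt
    have : n = 1 ∨ n = 2 := by omega
    rcases this with rfl | rfl
    · exact hne1 i (hn ▸ hgij.symm)
    · exact hnb i (hn ▸ hgij.symm)
  have : NeZero n := ⟨by omega⟩
  have hsucc : ∀ k : ZMod n, g (i + (k + 1).val) = g (i + k.val + 1) := by
    intro k
    have hk := ZMod.val_lt k
    by_cases hlast : k.val + 1 = n
    · have : k + 1 = 0 := by
        rw [← ZMod.natCast_zmod_val k, ← Nat.cast_one, ← Nat.cast_add, hlast, ZMod.natCast_self]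
      rw [this, ZMod.val_zero, add_zero, hgij, hn, add_assoc, hlast]
    · rw [ZMod.val_add_of_lt, ZMod.val_one'' (by omega), add_assoc]
      rw [ZMod.val_one'' (by omega)]
      omega
  refine ⟨⟨n, hn3, fun k => g (i + k.val), ?_, ?_⟩, ?_⟩
  · intro k l hkl
    have hk := ZMod.val_lt k
    have hl := ZMod.val_lt l
    apply ZMod.val_injective n
    rcases lt_trichotomy k.val l.val with h | h | h
    · exact absurd hkl (hmin _ (by omega) _ (by omega))
    · exact h
    · exact absurd hkl.symm (hmin _ (by omega) _ (by omega))
  · intro k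
    simp only [hsucc]
    exact hadj _
  · rintro e ⟨k, rfl⟩
    simp only [hsucc]
    exact hE' _

/-- The open unit square of index `z`. -/
def openSquare (z : GridV) : Set (ℝ × ℝ) :=
  Set.Ioo ((z.1 : ℝ) - 1 / 2) (z.1 + 1 / 2) ×ˢ Set.Ioo ((z.2 : ℝ) - 1 / 2) (z.2 + 1 / 2)

theorem squareSet_eq_prod (z : GridV) : squareSet z =
    Set.Icc ((z.1 : ℝ) - 1 / 2) (z.1 + 1 / 2) ×ˢ Set.Icc ((z.2 : ℝ) - 1 / 2) (z.2 + 1 / 2) := by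
  rw [squareSet, Set.Icc_prod_eq]

theorem mem_squareSet {z : GridV} {p : ℝ × ℝ} : p ∈ squareSet z ↔
    ((z.1 : ℝ) - 1 / 2 ≤ p.1 ∧ p.1 ≤ z.1 + 1 / 2) ∧
      (z.2 : ℝ) - 1 / 2 ≤ p.2 ∧ p.2 ≤ z.2 + 1 / 2 := by
  rw [squareSet_eq_prod]; rfl

theorem mem_openSquare {z : GridV} {p : ℝ × ℝ} : p ∈ openSquare z ↔
    ((z.1 : ℝ) - 1 / 2 < p.1 ∧ p.1 < z.1 + 1 / 2) ∧
      (z.2 : ℝ) - 1 / 2 < p.2 ∧ p.2 < z.2 + 1 / 2 := Iff.rfl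

theorem center_mem_openSquare (z : GridV) : ((z.1, z.2) : ℝ × ℝ) ∈ openSquare z := by
  rw [mem_openSquare]; norm_num

theorem openSquare_subset_squareSet (z : GridV) : openSquare z ⊆ squareSet z := by
  intro p hp
  rw [mem_openSquare] at hp
  rw [mem_squareSet]
  exact ⟨⟨hp.1.1.le, hp.1.2.le⟩, hp.2.1.le, hp.2.2.le⟩

theorem squareSet_subset_closure (z : GridV) : squareSet z ⊆ closure (openSquare z) := by
  rw [squareSet_eq_prod, openSquare, closure_prod_eq, closure_Ioo, closure_Ioo] <;>
    linarith

theorem isPreconnected_openSquare (z : GridV) : IsPreconnected (openSquare z) :=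
  isPreconnected_Ioo.prod isPreconnected_Ioo

theorem isClosed_squareSet (z : GridV) : IsClosed (squareSet z) := isClosed_Icc

theorem exists_mem_squareSet (p : ℝ × ℝ) : ∃ z, p ∈ squareSet z := by
  refine ⟨(⌊p.1 + 1 / 2⌋, ⌊p.2 + 1 / 2⌋), mem_squareSet.2 ?_⟩
  have h1 := Int.floor_le (p.1 + 1 / 2)
  have h2 := Int.lt_floor_add_one (p.1 + 1 / 2)
  have h3 := Int.floor_le (p.2 + 1 / 2)
  have h4 := Int.lt_floor_add_one (p.2 + 1 / 2)
  exact ⟨⟨by linarith, by linarith⟩, by linarith, by linarith⟩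

theorem mem_edgeSeg_hEdge {x y : ℤ} {p : ℝ × ℝ} : p ∈ edgeSeg (hEdge x y) ↔
    ((x : ℝ) - 1 / 2 ≤ p.1 ∧ p.1 ≤ x + 1 / 2) ∧ p.2 = y - 1 / 2 := by
  have : edgeSeg (hEdge x y) = segment ℝ ((x : ℝ) - 1 / 2, (y : ℝ) - 1 / 2)
      ((x : ℝ) + 1 / 2, (y : ℝ) - 1 / 2) := by
    simp only [edgeSeg, hEdge, Sym2.lift_mk, toPlane]
    congr 2
    push_cast
    ring
  rw [this, ← Prod.image_mk_segment_left, segment_eq_Icc (by linarith)]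
  obtain ⟨p1, p2⟩ := p
  simp [eq_comm, and_assoc]

theorem mem_edgeSeg_vEdge {x y : ℤ} {p : ℝ × ℝ} : p ∈ edgeSeg (vEdge x y) ↔
    p.1 = x - 1 / 2 ∧ (y : ℝ) - 1 / 2 ≤ p.2 ∧ p.2 ≤ y + 1 / 2 := by
  have : edgeSeg (vEdge x y) = segment ℝ ((x : ℝ) - 1 / 2, (y : ℝ) - 1 / 2)
      ((x : ℝ) - 1 / 2, (y : ℝ) + 1 / 2) := by
    simp only [edgeSeg, vEdge, Sym2.lift_mk, toPlane]
    congr 2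
    push_cast
    ring
  rw [this, ← Prod.image_mk_segment_right, segment_eq_Icc (by linarith)]
  obtain ⟨p1, p2⟩ := p
  simp [eq_comm, and_comm, and_assoc]

theorem mem_carrierOf {E : Set (Sym2 GridV)} {p : ℝ × ℝ} :
    p ∈ carrierOf E ↔ ∃ e ∈ E, p ∈ edgeSeg e := by
  simp [carrierOf]

theorem Separates.edgeSeg_subset {e : Sym2 GridV} {z w : GridV} (h : Separates e z w) :
    edgeSeg e ⊆ squareSet z := by
  intro p hp
  rw [mem_squareSet]
  cases h <;> simp only [mem_edgeSeg_hEdge, mem_edgeSeg_vEdge] at hp <;> push_cast <;>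
    refine ⟨⟨?_, ?_⟩, ?_, ?_⟩ <;> linarith [hp.1, hp.2]

theorem notMem_carrierOf_of_mem_openSquare {E : Set (Sym2 GridV)} (hE : ∀ e ∈ E, IsGridEdge e)
    {z : GridV} {p : ℝ × ℝ} (hp : p ∈ openSquare z) : p ∉ carrierOf E := by
  have key : ∀ (m n : ℤ), (m : ℝ) - 1 / 2 < n - 1 / 2 → (n : ℝ) - 1 / 2 < m + 1 / 2 → False := by
    intro m n h1 h2
    have h1 : (m : ℝ) < n := by linarith
    have h2 : (n : ℝ) < m + 1 := by linarith
    have h1 : m < n := by exact_mod_cast h1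
    have h2 : n < m + 1 := by exact_mod_cast h2
    omega
  rw [mem_carrierOf]
  rintro ⟨e, he, hpe⟩
  rw [mem_openSquare] at hp
  obtain ⟨x, y, rfl | rfl⟩ := hE e he
  · rw [mem_edgeSeg_hEdge] at hpe
    exact key z.2 y (by linarith) (by linarith)
  · rw [mem_edgeSeg_vEdge] at hpe
    exact key z.1 x (by linarith) (by linarith)

theorem Separates.exists_mem_edgeSeg {E : Set (Sym2 GridV)} (hE : ∀ e ∈ E, IsGridEdge e)
    {e : Sym2 GridV} {z w : GridV} (h : Separates e z w) (he : e ∉ E) :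
    ∃ p ∈ edgeSeg e, p ∉ carrierOf E := by
  have key : ∀ (m n : ℤ), (m : ℝ) ≠ n - 1 / 2 := by
    intro m n h
    have h : (2 * m : ℝ) = 2 * n - 1 := by linarith
    have h : 2 * m = 2 * n - 1 := by exact_mod_cast h
    omega
  have key' : ∀ (m n : ℤ), (n : ℝ) - 1 / 2 ≤ m → (m : ℝ) ≤ n + 1 / 2 → m = n := by
    intro m n h1 h2
    have h1 : (n : ℝ) < m + 1 := by linarith
    have h2 : (m : ℝ) < n + 1 := by linarith
    have h1 : n < m + 1 := by exact_mod_cast h1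
    have h2 : m < n + 1 := by exact_mod_cast h2
    omega
  obtain ⟨x, y, rfl | rfl⟩ := h.isGridEdge
  · refine ⟨((x : ℝ), (y : ℝ) - 1 / 2), mem_edgeSeg_hEdge.2 (by norm_num), fun hp => ?_⟩
    obtain ⟨e', he', hp⟩ := mem_carrierOf.1 hp
    obtain ⟨x', y', rfl | rfl⟩ := hE e' he'
    · rw [mem_edgeSeg_hEdge] at hp
      have hx := key' x x' hp.1.1 hp.1.2
      have hy : (y : ℝ) = y' := by linarith [hp.2]
      have hy : y = y' := by exact_mod_cast hy
      subst hx hy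
      exact he he'
    · exact key _ _ (mem_edgeSeg_vEdge.1 hp).1
  · refine ⟨((x : ℝ) - 1 / 2, (y : ℝ)), mem_edgeSeg_vEdge.2 (by norm_num), fun hp => ?_⟩
    obtain ⟨e', he', hp⟩ := mem_carrierOf.1 hp
    obtain ⟨x', y', rfl | rfl⟩ := hE e' he'
    · exact key _ _ (mem_edgeSeg_hEdge.1 hp).2
    · rw [mem_edgeSeg_vEdge] at hp
      have hy := key' y y' hp.2.1 hp.2.2
      have hx : (x : ℝ) = x' := by linarith [hp.1]
      have hx : x = x' := by exact_mod_cast hx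
      subst hx hy
      exact he he'

theorem openSquare_subset_connectedComponentIn {E : Set (Sym2 GridV)}
    (hE : ∀ e ∈ E, IsGridEdge e) {z : GridV} {p : ℝ × ℝ} (hp : p ∉ carrierOf E)
    (hz : p ∈ squareSet z) : openSquare z ⊆ connectedComponentIn (carrierOf E)ᶜ p := by
  have h1 : IsPreconnected (insert p (openSquare z)) := by
    refine (isPreconnected_openSquare z).subset_closure (Set.subset_insert _ _) ?_
    exact Set.insert_subset (squareSet_subset_closure z hz) subset_closure
  refine (Set.subset_insert _ _).trans
    (h1.subset_connectedComponentIn (Set.mem_insert _ _) ?_)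
  refine Set.insert_subset hp fun q hq => ?_
  exact notMem_carrierOf_of_mem_openSquare hE hq

/-- The union of the closed squares with index in `L`. -/
def cellUnion (L : Set GridV) : Set (ℝ × ℝ) := ⋃ z ∈ L, squareSet z

theorem mem_cellUnion {L : Set GridV} {p : ℝ × ℝ} :
    p ∈ cellUnion L ↔ ∃ z ∈ L, p ∈ squareSet z := by
  simp [cellUnion]

theorem locallyFinite_squareSet : LocallyFinite squareSet := by
  intro p
  refine ⟨Metric.ball p 1, Metric.ball_mem_nhds _ one_pos, ?_⟩
  refine (Set.finite_Icc ((⌊p.1⌋ - 2, ⌊p.2⌋ - 2) : GridV) (⌊p.1⌋ + 3, ⌊p.2⌋ + 3)).subset ?_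
  rintro ⟨x, y⟩ ⟨q, hq, hqp⟩
  rw [mem_squareSet] at hq
  rw [Metric.mem_ball, Prod.dist_eq, max_lt_iff, Real.dist_eq, Real.dist_eq, abs_lt, abs_lt] at hqp
  have h1 := Int.floor_le p.1
  have h2 := Int.lt_floor_add_one p.1
  have h3 := Int.floor_le p.2
  have h4 := Int.lt_floor_add_one p.2
  dsimp only at hq
  simp only [Set.mem_Icc, Prod.mk_le_mk]
  refine ⟨⟨?_, ?_⟩, ?_, ?_⟩
  · have : (⌊p.1⌋ : ℝ) - 2 ≤ x := by linarith
    exact_mod_cast this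
  · have : (⌊p.2⌋ : ℝ) - 2 ≤ y := by linarith
    exact_mod_cast this
  · have : (x : ℝ) ≤ ⌊p.1⌋ + 3 := by linarith
    exact_mod_cast this
  · have : (y : ℝ) ≤ ⌊p.2⌋ + 3 := by linarith
    exact_mod_cast this

theorem isClosed_cellUnion (L : Set GridV) : IsClosed (cellUnion L) := by
  rw [cellUnion, Set.biUnion_eq_iUnion]
  exact (locallyFinite_squareSet.comp_injective Subtype.val_injective).isClosed_iUnion
    fun z => isClosed_squareSet _

theorem isBounded_cellUnion {L : Set GridV} (hL : L.Finite) :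
    Bornology.IsBounded (cellUnion L) :=
  (Bornology.isBounded_biUnion hL).2 fun _ _ => Metric.isBounded_Icc _ _

theorem exists_separates_of_mem_squareSet {z w : GridV} {p : ℝ × ℝ} (hz : p ∈ squareSet z)
    (hw : p ∈ squareSet w) (h : z.1 = w.1 ∨ z.2 = w.2) (hne : z ≠ w) :
    ∃ e, Separates e z w ∧ p ∈ edgeSeg e := by
  rw [mem_squareSet] at hz hw
  obtain ⟨x, y⟩ := z
  obtain ⟨x', y'⟩ := w
  dsimp only at *
  rcases h with rfl | rfl
  · have hle : (y : ℝ) ≤ y' + 1 := by linarith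
    have hle' : (y' : ℝ) ≤ y + 1 := by linarith
    have hle : y ≤ y' + 1 := by exact_mod_cast hle
    have hle' : y' ≤ y + 1 := by exact_mod_cast hle'
    have hyy : y ≠ y' := fun h => hne (by rw [h])
    rcases (by omega : y' = y - 1 ∨ y = y' - 1) with rfl | rfl
    · push_cast at hw
      exact ⟨_, .down x y, mem_edgeSeg_hEdge.2 ⟨hz.1, by linarith⟩⟩
    · push_cast at hz
      exact ⟨_, .up x y', mem_edgeSeg_hEdge.2 ⟨hz.1, by linarith⟩⟩
  · have hle : (x : ℝ) ≤ x' + 1 := by linarith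
    have hle' : (x' : ℝ) ≤ x + 1 := by linarith
    have hle : x ≤ x' + 1 := by exact_mod_cast hle
    have hle' : x' ≤ x + 1 := by exact_mod_cast hle'
    have hxx : x ≠ x' := fun h => hne (by rw [h])
    rcases (by omega : x' = x - 1 ∨ x = x' - 1) with rfl | rfl
    · push_cast at hw
      exact ⟨_, .left x y, mem_edgeSeg_vEdge.2 ⟨by linarith, hz.2⟩⟩
    · push_cast at hz
      exact ⟨_, .right x' y, mem_edgeSeg_vEdge.2 ⟨by linarith, hz.2⟩⟩

theorem mem_carrierOf_cellBoundary {L : Set GridV} {z w : GridV} {p : ℝ × ℝ}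
    (hz : p ∈ squareSet z) (hw : p ∈ squareSet w) (hzL : z ∈ L) (hwL : w ∉ L) :
    p ∈ carrierOf (cellBoundary L) := by
  have hm : p ∈ squareSet (z.1, w.2) := mem_squareSet.2
    ⟨(mem_squareSet.1 hz).1, (mem_squareSet.1 hw).2⟩
  rw [mem_carrierOf]
  by_cases hmL : (z.1, w.2) ∈ L
  · obtain ⟨e, he, hp⟩ := exists_separates_of_mem_squareSet hm hw (.inr rfl)
      (fun h => hwL (h ▸ hmL))
    exact ⟨e, ⟨_, hmL, _, hwL, he⟩, hp⟩
  · obtain ⟨e, he, hp⟩ := exists_separates_of_mem_squareSet hz hm (.inl rfl)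
      (fun h => hmL (h ▸ hzL))
    exact ⟨e, ⟨_, hzL, _, hmL, he⟩, hp⟩

theorem isBounded_connectedComponentIn {L : Set GridV} (hL : L.Finite) {z : GridV} {p : ℝ × ℝ}
    (hp : p ∉ carrierOf (cellBoundary L)) (hz : p ∈ squareSet z) (hzL : z ∈ L) :
    Bornology.IsBounded (connectedComponentIn (carrierOf (cellBoundary L))ᶜ p) := by
  refine (isBounded_cellUnion hL).subset ?_
  have hsub := connectedComponentIn_subset (carrierOf (cellBoundary L))ᶜ p
  set K := connectedComponentIn (carrierOf (cellBoundary L))ᶜ p with hK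
  have hcov : K ⊆ cellUnion L ∪ cellUnion Lᶜ := by
    intro q _
    obtain ⟨w, hw⟩ := exists_mem_squareSet q
    by_cases hwL : w ∈ L
    · exact .inl (mem_cellUnion.2 ⟨w, hwL, hw⟩)
    · exact .inr (mem_cellUnion.2 ⟨w, hwL, hw⟩)
  have hdisj : K ∩ (cellUnion L ∩ cellUnion Lᶜ) = ∅ := by
    refine Set.eq_empty_of_forall_notMem ?_
    rintro q ⟨hq, hq1, hq2⟩
    obtain ⟨w, hw, hqw⟩ := mem_cellUnion.1 hq1
    obtain ⟨w', hw', hqw'⟩ := mem_cellUnion.1 hq2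
    exact hsub hq (mem_carrierOf_cellBoundary hqw hqw' hw hw')
  rcases isPreconnected_iff_subset_of_disjoint_closed.1
    (isPreconnected_connectedComponentIn (F := (carrierOf (cellBoundary L))ᶜ) (x := p))
    (cellUnion L) (cellUnion Lᶜ) (isClosed_cellUnion _) (isClosed_cellUnion _) hcov hdisj
    with h | h
  · exact h
  · obtain ⟨w, hw, hpw⟩ := mem_cellUnion.1 (h (mem_connectedComponentIn hp))
    exact absurd (mem_carrierOf_cellBoundary hz hpw hzL hw) hp

theorem finite_setOf_openSquare_subset {S : Set (ℝ × ℝ)} (hS : Bornology.IsBounded S) :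
    {z : GridV | openSquare z ⊆ S}.Finite := by
  obtain ⟨R, hR⟩ := hS.subset_closedBall (0 : ℝ × ℝ)
  refine (Set.finite_Icc ((-⌈R⌉, -⌈R⌉) : GridV) (⌈R⌉, ⌈R⌉)).subset ?_
  rintro ⟨x, y⟩ hz
  have h := hR (hz (center_mem_openSquare (x, y)))
  rw [Metric.mem_closedBall, Prod.dist_eq, max_le_iff, Real.dist_eq, Real.dist_eq, abs_le,
    abs_le] at h
  simp only [Prod.fst_zero, Prod.snd_zero, sub_zero] at h
  have hc := Int.le_ceil R
  simp only [Set.mem_Icc, Prod.mk_le_mk]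
  refine ⟨⟨?_, ?_⟩, ?_, ?_⟩
  · have : -(⌈R⌉ : ℝ) ≤ x := by linarith
    exact_mod_cast this
  · have : -(⌈R⌉ : ℝ) ≤ y := by linarith
    exact_mod_cast this
  · have : (x : ℝ) ≤ ⌈R⌉ := by linarith
    exact_mod_cast this
  · have : (y : ℝ) ≤ ⌈R⌉ := by linarith
    exact_mod_cast this

/-- A form of the Jordan curve theorem for grid cycles. -/
theorem GridCycle.mem_interiorOf_iff (C : GridCycle) {L : Set GridV} (hL : L.Finite)
    (hC : cellBoundary L = C.edgeSet) {z : GridV} {p : ℝ × ℝ} (hp : p ∉ carrierOf C.edgeSet)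
    (hz : p ∈ squareSet z) : p ∈ interiorOf C.edgeSet ↔ z ∈ L := by
  have hgrid := C.isEven_edgeSet.grid
  constructor
  · rintro ⟨-, hb⟩
    by_contra hzL
    set T : Set GridV := {w | openSquare w ⊆ connectedComponentIn (carrierOf C.edgeSet)ᶜ p}
      with hT
    have hTfin : T.Finite := finite_setOf_openSquare_subset hb
    have hzT : z ∈ T := openSquare_subset_connectedComponentIn hgrid hp hz
    have hTsub : cellBoundary T ⊆ C.edgeSet := by
      rintro e ⟨a, ha, b, hbT, hs⟩
      by_contra he
      obtain ⟨q, hqe, hq⟩ := hs.exists_mem_edgeSeg hgrid he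
      have h1 := openSquare_subset_connectedComponentIn hgrid hq (hs.edgeSeg_subset hqe)
      have h2 := openSquare_subset_connectedComponentIn hgrid hq (hs.symm.edgeSeg_subset hqe)
      have h3 := connectedComponentIn_eq (h1 (center_mem_openSquare a))
      have h4 := connectedComponentIn_eq (ha (center_mem_openSquare a))
      rw [h3, ← h4] at h2
      exact hbT h2
    have hTne : (cellBoundary T).Nonempty := by
      rw [Set.nonempty_iff_ne_empty]
      intro h
      rw [eq_empty_of_cellBoundary_eq_empty hTfin h] at hzT
      exact hzT
    have hTeq := C.eq_edgeSet_of_isEven (isEven_cellBoundary hTfin) hTne hTsub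
    rw [← hC] at hTeq
    rw [cellBoundary_injOn hTfin hL hTeq] at hzT
    exact hzL hzT
  · intro hzL
    rw [← hC] at hp ⊢
    exact ⟨hp, isBounded_connectedComponentIn hL hp hz hzL⟩

theorem GridCycle.exists_cells (C : GridCycle) :
    ∃ F : Set GridV, F.Finite ∧ F.Nonempty ∧ cellBoundary F = C.edgeSet := by
  obtain ⟨F, hF, hC⟩ := C.isEven_edgeSet.exists_cellBoundary
  refine ⟨F, hF, Set.nonempty_iff_ne_empty.2 ?_, hC⟩
  rintro rfl
  rw [cellBoundary_empty] at hC
  exact C.nonempty_edgeSet.ne_empty hC.symm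

theorem GridCycle.eq_empty_or_eq_cells (C : GridCycle) {F S : Set GridV} (hF : F.Finite)
    (hC : cellBoundary F = C.edgeSet) (hS : S.Finite) (hSC : cellBoundary S ⊆ C.edgeSet) :
    S = ∅ ∨ S = F := by
  rcases (cellBoundary S).eq_empty_or_nonempty with h | h
  · exact .inl (eq_empty_of_cellBoundary_eq_empty hS h)
  · refine .inr (cellBoundary_injOn hS hF ?_)
    rw [hC]
    exact C.eq_edgeSet_of_isEven (isEven_cellBoundary hS) h hSC

/-- The union of all finite sets of squares bounded by edges of `G`. -/
def filling (G : Set (Sym2 GridV)) : Set GridV :=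
  {z | ∃ L : Set GridV, L.Finite ∧ cellBoundary L ⊆ G ∧ z ∈ L}

theorem subset_filling {G : Set (Sym2 GridV)} {L : Set GridV} (hL : L.Finite)
    (h : cellBoundary L ⊆ G) : L ⊆ filling G :=
  fun _ hz => ⟨L, hL, h, hz⟩

theorem cellBoundary_filling_subset (G : Set (Sym2 GridV)) : cellBoundary (filling G) ⊆ G := by
  rintro e ⟨z, ⟨L, hL, hLG, hz⟩, w, hw, hs⟩
  exact hLG ⟨z, hz, w, fun h => hw (subset_filling hL hLG h), hs⟩

theorem finite_filling {G : Set (Sym2 GridV)} (hG : G.Finite) : (filling G).Finite := by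
  obtain ⟨a, b, hab⟩ := exists_bounds hG
  refine (Set.finite_Icc a b).subset ?_
  rintro ⟨x, y⟩ ⟨L, hL, hLG, hz⟩
  obtain ⟨j, hj, hjL⟩ := exists_vEdge_right hL hz
  obtain ⟨i, hi, hiL⟩ := exists_vEdge_left hL hz
  have h1 := (hab j y (.inr (hLG hjL))).2
  have h2 := (hab i y (.inr (hLG hiL))).1
  exact ⟨Prod.mk_le_mk.2 ⟨h2.1.trans hi, h2.2⟩, Prod.mk_le_mk.2 ⟨hj.le.trans h1.1, h1.2⟩⟩

section Dichotomy

variable {C₁ C₂ : GridCycle} {F₁ F₂ K L : Set GridV}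

theorem not_separates_of_cellBoundary_subset (hLK : L ⊆ K)
    (hb : cellBoundary L ⊆ cellBoundary K) {e : Sym2 GridV} {z w : GridV} (hz : z ∈ L)
    (hwK : w ∈ K) (hwL : w ∉ L) : ¬ Separates e z w := by
  intro hs
  have h := hb ⟨z, hz, w, hwL, hs⟩
  rw [hs.mem_cellBoundary_iff] at h
  exact h (iff_of_true (hLK hz) hwK)

theorem GridCycle.inter_eq_empty_or_subset (C : GridCycle) {F : Set GridV} (hF : F.Finite)
    (hC : cellBoundary F = C.edgeSet) (hFK : F ⊆ K) (hLK : L ⊆ K)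
    (hb : cellBoundary L ⊆ cellBoundary K) : F ∩ L = ∅ ∨ F ⊆ L := by
  rw [← Set.inter_eq_left]
  refine C.eq_empty_or_eq_cells hF hC (hF.subset Set.inter_subset_left) ?_
  rintro e ⟨z, hz, w, hw, hs⟩
  rw [← hC]
  refine ⟨z, hz.1, w, fun hwF => ?_, hs⟩
  exact not_separates_of_cellBoundary_subset hLK hb hz.2 (hFK hwF) (fun h => hw ⟨hwF, h⟩) hs

theorem eq_of_subset_of_inter_eq_empty (hF₁ : F₁.Finite) (hF₂ : F₂.Finite) (hne : F₂.Nonempty)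
    (h₁ : cellBoundary F₁ = C₁.edgeSet) (h₂ : cellBoundary F₂ = C₂.edgeSet) (hK : K.Finite)
    (hKC : cellBoundary K ⊆ C₁.edgeSet ∪ C₂.edgeSet) (hK₂ : F₂ ⊆ K)
    (hLne : L.Nonempty) (hLK : L ⊆ K) (hb : cellBoundary L ⊆ cellBoundary K)
    (hL₁ : F₁ ⊆ L) (hL₂ : F₂ ∩ L = ∅) :
    Disjoint C₁.edgeSet C₂.edgeSet ∧ cellBoundary K = C₁.edgeSet ∪ C₂.edgeSet ∧ L = F₁ := by
  have hsep := fun e z w => not_separates_of_cellBoundary_subset (e := e) (z := z) (w := w) hLK hb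
  have hL₂' : ∀ z ∈ L, z ∉ F₂ := fun z hz hz2 =>
    Set.notMem_empty z (hL₂ ▸ (⟨hz2, hz⟩ : z ∈ F₂ ∩ L))
  have hLF : L = F₁ := by
    refine (C₁.eq_empty_or_eq_cells hF₁ h₁ (hK.subset hLK) ?_).resolve_left hLne.ne_empty
    rintro e ⟨z, hz, w, hw, hs⟩
    refine (hKC (hb ⟨z, hz, w, hw, hs⟩)).resolve_right ?_
    rw [← h₂, hs.mem_cellBoundary_iff]
    have hwK : w ∉ K := fun h => hsep e z w hz h hw hs
    exact fun h => h (iff_of_false (hL₂' z hz) fun h => hwK (hK₂ h))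
  have hM : K \ L = F₂ := by
    refine (C₂.eq_empty_or_eq_cells hF₂ h₂ (hK.subset Set.sdiff_subset) ?_).resolve_left ?_
    · rintro e ⟨z, hz, w, hw, hs⟩
      have hwL : w ∉ L := fun h => hsep e w z h hz.1 hz.2 hs.symm
      have hwK : w ∉ K := fun h => hw ⟨h, hwL⟩
      refine (hKC ⟨z, hz.1, w, hwK, hs⟩).resolve_left ?_
      rw [← h₁, hs.mem_cellBoundary_iff]
      exact fun h => h (iff_of_false (fun h => hz.2 (hL₁ h)) fun h => hwL (hL₁ h))
    · obtain ⟨z, hz⟩ := hne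
      exact Set.Nonempty.ne_empty ⟨z, hK₂ hz, fun h => hL₂' z h hz⟩
  refine ⟨?_, hKC.antisymm (Set.union_subset ?_ ?_), hLF⟩
  · rw [Set.disjoint_left, ← h₁, ← h₂]
    rintro e ⟨z, hz, w, hw, hs⟩ he
    rw [hs.mem_cellBoundary_iff] at he
    have hz2 := hL₂' z (hL₁ hz)
    have hw2 : w ∈ F₂ := by tauto
    exact hsep e z w (hL₁ hz) (hK₂ hw2) (fun h => hL₂' w h hw2) hs
  · rwa [← h₁, ← hLF]
  · rw [← h₂]
    rintro e ⟨z, hz, w, hw, hs⟩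
    refine ⟨z, hK₂ hz, w, fun hwK => ?_, hs⟩
    have hwL : w ∈ L := by
      by_contra hwL
      exact hw (hM ▸ ⟨hwK, hwL⟩)
    exact hsep e w z hwL (hK₂ hz) (fun h => hL₂' z h hz) hs.symm

theorem eq_or_disjoint_of_cellBoundary_subset (hF₁ : F₁.Finite) (hF₂ : F₂.Finite)
    (hne₁ : F₁.Nonempty) (hne₂ : F₂.Nonempty)
    (h₁ : cellBoundary F₁ = C₁.edgeSet) (h₂ : cellBoundary F₂ = C₂.edgeSet) (hK : K.Finite)
    (hKC : cellBoundary K ⊆ C₁.edgeSet ∪ C₂.edgeSet) (hK₁ : F₁ ⊆ K) (hK₂ : F₂ ⊆ K)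
    (hLne : L.Nonempty) (hLK : L ⊆ K) (hb : cellBoundary L ⊆ cellBoundary K) :
    L = K ∨ Disjoint C₁.edgeSet C₂.edgeSet ∧ cellBoundary K = C₁.edgeSet ∪ C₂.edgeSet ∧
      (L = F₁ ∨ L = F₂) := by
  have hsep := fun e z w => not_separates_of_cellBoundary_subset (e := e) (z := z) (w := w) hLK hb
  rcases C₁.inter_eq_empty_or_subset hF₁ h₁ hK₁ hLK hb with hL₁ | hL₁ <;>
  rcases C₂.inter_eq_empty_or_subset hF₂ h₂ hK₂ hLK hb with hL₂ | hL₂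
  · exfalso
    refine hLne.ne_empty (eq_empty_of_cellBoundary_eq_empty (hK.subset hLK) ?_)
    refine Set.eq_empty_of_forall_notMem ?_
    rintro e ⟨z, hz, w, hw, hs⟩
    have hwK : w ∉ K := fun h => hsep e z w hz h hw hs
    rcases hKC (hb ⟨z, hz, w, hw, hs⟩) with h | h
    · rw [← h₁, hs.mem_cellBoundary_iff] at h
      exact h (iff_of_false (fun h => Set.notMem_empty z (hL₁ ▸ (⟨h, hz⟩ : z ∈ F₁ ∩ L)))
        fun h => hwK (hK₁ h))
    · rw [← h₂, hs.mem_cellBoundary_iff] at h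
      exact h (iff_of_false (fun h => Set.notMem_empty z (hL₂ ▸ (⟨h, hz⟩ : z ∈ F₂ ∩ L)))
        fun h => hwK (hK₂ h))
  · obtain ⟨hd, hu, hL⟩ := eq_of_subset_of_inter_eq_empty hF₂ hF₁ hne₁ h₂ h₁ hK
      (Set.union_comm _ _ ▸ hKC) hK₁ hLne hLK hb hL₂ hL₁
    exact .inr ⟨hd.symm, Set.union_comm _ _ ▸ hu, .inr hL⟩
  · obtain ⟨hd, hu, hL⟩ := eq_of_subset_of_inter_eq_empty hF₁ hF₂ hne₂ h₁ h₂ hK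
      hKC hK₂ hLne hLK hb hL₁ hL₂
    exact .inr ⟨hd, hu, .inl hL⟩
  · refine .inl (hLK.antisymm (Set.sdiff_eq_empty.1 ?_))
    refine eq_empty_of_cellBoundary_eq_empty (hK.subset Set.sdiff_subset) ?_
    refine Set.eq_empty_of_forall_notMem ?_
    rintro e ⟨z, hz, w, hw, hs⟩
    have hwL : w ∉ L := fun h => hsep e w z h hz.1 hz.2 hs.symm
    have hwK : w ∉ K := fun h => hw ⟨h, hwL⟩
    rcases hKC ⟨z, hz.1, w, hwK, hs⟩ with h | h
    · rw [← h₁, hs.mem_cellBoundary_iff] at h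
      exact h (iff_of_false (fun h => hz.2 (hL₁ h)) fun h => hwL (hL₁ h))
    · rw [← h₂, hs.mem_cellBoundary_iff] at h
      exact h (iff_of_false (fun h => hz.2 (hL₂ h)) fun h => hwL (hL₂ h))

end Dichotomy

theorem chi_union {α : Type*} {A B : Set α} (h : Disjoint A B) :
    chi (A ∪ B) = chi A + chi B := by
  funext e
  by_cases ha : e ∈ A
  · have := Set.disjoint_left.1 h ha
    simp [chi, ha, this]
  · by_cases hb : e ∈ B <;> simp [chi, ha, hb]

theorem exists_isEven_of_disjoint {C₁ C₂ : GridCycle} (hd : Disjoint C₁.edgeSet C₂.edgeSet)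
    (hcommon : ¬ (vertexSetOf C₁.edgeSet ∩ vertexSetOf C₂.edgeSet).Subsingleton) :
    ∃ D ⊆ C₁.edgeSet ∪ C₂.edgeSet, IsEven D ∧ D.Nonempty ∧ D ≠ C₁.edgeSet ∪ C₂.edgeSet ∧
      D ≠ C₁.edgeSet ∧ D ≠ C₂.edgeSet := by
  simp only [Set.Subsingleton, not_forall] at hcommon
  obtain ⟨u, hu, v, hv, huv⟩ := hcommon
  obtain ⟨A, hA, hAdeg⟩ := C₁.exists_arc hu.1 hv.1
  obtain ⟨B, hB, hBdeg⟩ := C₂.exists_arc hu.2 hv.2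
  have hAu : chainDeg (chi A) u = 1 := by
    rw [hAdeg, chi_of_mem (Set.mem_singleton _), chi_of_notMem (E := {v}) huv, add_zero]
  have hAne : A ≠ ∅ := by
    rintro rfl
    simp [chainDeg, chi] at hAu
  have hA1 : A ≠ C₁.edgeSet := by
    rintro rfl
    rw [C₁.isEven_edgeSet.deg] at hAu
    exact absurd hAu (by decide)
  have hAB : (A ∪ B) ∩ C₁.edgeSet = A := by
    rw [Set.union_inter_distrib_right, Set.inter_eq_left.2 hA,
      (hd.symm.mono_left hB).inter_eq, Set.union_empty]
  refine ⟨A ∪ B, Set.union_subset_union hA hB, ⟨?_, ?_, fun w => ?_⟩, ?_, ?_, ?_, ?_⟩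
  · exact (C₁.isEven_edgeSet.finite.subset hA).union (C₂.isEven_edgeSet.finite.subset hB)
  · rintro e (he | he)
    · exact C₁.isEven_edgeSet.grid e (hA he)
    · exact C₂.isEven_edgeSet.grid e (hB he)
  · rw [chi_union (hd.mono hA hB), chainDeg_add, hAdeg, hBdeg, CharTwo.add_self_eq_zero]
  · exact (Set.nonempty_iff_ne_empty.2 hAne).inl
  · intro h
    rw [h, Set.inter_eq_right.2 Set.subset_union_left] at hAB
    exact hA1 hAB.symm
  · intro h
    rw [h, Set.inter_self] at hAB
    exact hA1 hAB.symm
  · intro h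
    rw [h, hd.symm.inter_eq] at hAB
    exact hAne hAB.symm

theorem exists_gridCycle_cellBoundary_filling {C₁ C₂ : GridCycle}
    (hcommon : ¬ (vertexSetOf C₁.edgeSet ∩ vertexSetOf C₂.edgeSet).Subsingleton) :
    ∃ C : GridCycle, cellBoundary (filling (C₁.edgeSet ∪ C₂.edgeSet)) = C.edgeSet := by
  obtain ⟨F₁, hF₁, hne₁, h₁⟩ := C₁.exists_cells
  obtain ⟨F₂, hF₂, hne₂, h₂⟩ := C₂.exists_cells
  set K := filling (C₁.edgeSet ∪ C₂.edgeSet)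
  have hK : K.Finite := finite_filling (C₁.isEven_edgeSet.finite.union C₂.isEven_edgeSet.finite)
  have hKC : cellBoundary K ⊆ C₁.edgeSet ∪ C₂.edgeSet := cellBoundary_filling_subset _
  have hK₁ : F₁ ⊆ K := subset_filling hF₁ (h₁ ▸ Set.subset_union_left)
  have hK₂ : F₂ ⊆ K := subset_filling hF₂ (h₂ ▸ Set.subset_union_right)
  have hbne : (cellBoundary K).Nonempty := by
    rw [Set.nonempty_iff_ne_empty]
    intro h
    have := hne₁.mono hK₁
    rw [eq_empty_of_cellBoundary_eq_empty hK h] at this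
    exact Set.not_nonempty_empty this
  obtain ⟨C, hC⟩ := (isEven_cellBoundary hK).exists_gridCycle hbne
  obtain ⟨F, hF, hne, h⟩ := C.exists_cells
  rw [← h] at hC
  rcases eq_or_disjoint_of_cellBoundary_subset hF₁ hF₂ hne₁ hne₂ h₁ h₂ hK hKC hK₁ hK₂ hne
    (subset_filling hF (hC.trans hKC)) hC with hL | ⟨hd, hu, -⟩
  · exact ⟨C, hL ▸ h⟩
  · exfalso
    obtain ⟨D, hD, hDe, hDne, hD3, hD1, hD2⟩ := exists_isEven_of_disjoint hd hcommon
    obtain ⟨L, hL, rfl⟩ := hDe.exists_cellBoundary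
    have hLne : L.Nonempty := by
      rw [Set.nonempty_iff_ne_empty]
      rintro rfl
      exact hDne.ne_empty cellBoundary_empty
    rcases eq_or_disjoint_of_cellBoundary_subset hF₁ hF₂ hne₁ hne₂ h₁ h₂ hK hKC hK₁ hK₂ hLne
      (subset_filling hL hD) (hu ▸ hD) with rfl | ⟨-, -, rfl | rfl⟩
    · exact hD3 hu
    · exact hD1 h₁
    · exact hD2 h₂

theorem GridCycle.interiorOf_subset_iff {C D : GridCycle} {F K : Set GridV} (hF : F.Finite)
    (hK : K.Finite) (hC : cellBoundary F = C.edgeSet) (hD : cellBoundary K = D.edgeSet) :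
    interiorOf C.edgeSet ⊆ interiorOf D.edgeSet ↔ F ⊆ K := by
  constructor
  · intro h z hz
    have hp := center_mem_openSquare z
    have hp' := openSquare_subset_squareSet z hp
    rw [← D.mem_interiorOf_iff hK hD
      (notMem_carrierOf_of_mem_openSquare D.isEven_edgeSet.grid hp) hp']
    apply h
    rwa [C.mem_interiorOf_iff hF hC
      (notMem_carrierOf_of_mem_openSquare C.isEven_edgeSet.grid hp) hp']
  · intro h p hp
    obtain ⟨z, hz⟩ := exists_mem_squareSet p
    have hzF : z ∈ F := (C.mem_interiorOf_iff hF hC hp.1 hz).1 hp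
    have hpD : p ∉ carrierOf D.edgeSet := by
      rw [← hD, mem_carrierOf]
      rintro ⟨e, ⟨a, -, b, hb, hs⟩, hpe⟩
      have hpb := hs.symm.edgeSeg_subset hpe
      exact hb (h ((C.mem_interiorOf_iff hF hC hp.1 hpb).1 hp))
    exact (D.mem_interiorOf_iff hK hD hpD hz).2 (h hzF)

theorem GridCycle.inInterior_edgeSeg {C D : GridCycle} {F K : Set GridV}
    (hK : K.Finite) (hC : cellBoundary F = C.edgeSet) (hD : cellBoundary K = D.edgeSet)
    (h : F ⊆ K) {e : Sym2 GridV} (he : e ∈ C.edgeSet) : inInterior D.edgeSet (edgeSeg e) := by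
  intro p hp
  rw [← hC] at he
  obtain ⟨z, hz, w, -, hs⟩ := he
  by_cases hpD : p ∈ carrierOf D.edgeSet
  · exact .inr hpD
  · exact .inl ((D.mem_interiorOf_iff hK hD hpD (hs.edgeSeg_subset hp)).2 (h hz))

/-- If `C₁` and `C₂` are cycles of the full grid graph `G` having more
than one vertex in common, there is a unique cycle `C₃` consisting only of edges of `C₁`
and `C₂` such that: (i) the interior of `C₃` contains the interiors of `C₁` and `C₂`;
(ii) every edge of `C₁` or `C₂` belongs to `C₃` or is contained in its interior. -/
theorem merge_cycles_exists_unique (C₁ C₂ : Set (Sym2 GridV))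
    (h₁ : IsCycle C₁) (h₂ : IsCycle C₂)
    (hcommon : ¬ (vertexSetOf C₁ ∩ vertexSetOf C₂).Subsingleton) :
    ∃! C₃ : Set (Sym2 GridV), IsCycle C₃ ∧ C₃ ⊆ C₁ ∪ C₂ ∧
      interiorOf C₁ ⊆ interiorOf C₃ ∧ interiorOf C₂ ⊆ interiorOf C₃ ∧
      ∀ e ∈ C₁ ∪ C₂, e ∈ C₃ ∨ inInterior C₃ (edgeSeg e) := by
  obtain ⟨C₁, rfl⟩ := h₁
  obtain ⟨C₂, rfl⟩ := h₂
  obtain ⟨F₁, hF₁, hne₁, hC₁⟩ := C₁.exists_cells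
  obtain ⟨F₂, hF₂, -, hC₂⟩ := C₂.exists_cells
  obtain ⟨D, hD⟩ := exists_gridCycle_cellBoundary_filling hcommon
  have hKC := cellBoundary_filling_subset (C₁.edgeSet ∪ C₂.edgeSet)
  have hK := finite_filling (C₁.isEven_edgeSet.finite.union C₂.isEven_edgeSet.finite)
  have hK₁ := subset_filling hF₁ (hC₁.subset.trans (Set.subset_union_left (t := C₂.edgeSet)))
  have hK₂ := subset_filling hF₂ (hC₂.subset.trans (Set.subset_union_right (s := C₁.edgeSet)))
  refine ⟨D.edgeSet, ⟨⟨D, rfl⟩, hD ▸ hKC, ?_, ?_, ?_⟩, ?_⟩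
  · exact (GridCycle.interiorOf_subset_iff hF₁ hK hC₁ hD).2 hK₁
  · exact (GridCycle.interiorOf_subset_iff hF₂ hK hC₂ hD).2 hK₂
  · rintro e (he | he)
    · exact .inr (GridCycle.inInterior_edgeSeg hK hC₁ hD hK₁ he)
    · exact .inr (GridCycle.inInterior_edgeSeg hK hC₂ hD hK₂ he)
  · rintro _ ⟨⟨C, rfl⟩, hsub, hi₁, hi₂, -⟩
    obtain ⟨F, hF, -, hC⟩ := C.exists_cells
    rw [GridCycle.interiorOf_subset_iff hF₁ hF hC₁ hC] at hi₁
    rw [GridCycle.interiorOf_subset_iff hF₂ hF hC₂ hC] at hi₂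
    have hFK := subset_filling hF (hC ▸ hsub)
    rw [← hC, ← hD]
    refine congrArg _ (hFK.antisymm (Set.sdiff_eq_empty.1 ?_))
    refine (C.eq_empty_or_eq_cells hF hC (hK.subset Set.sdiff_subset) ?_).resolve_right ?_
    · rintro e ⟨z, hz, w, hw, hs⟩
      by_cases hwF : w ∈ F
      · exact hC ▸ ⟨w, hwF, z, hz.2, hs.symm⟩
      · exfalso
        rcases hKC ⟨z, hz.1, w, fun h => hw ⟨h, hwF⟩, hs⟩ with h | h
        · rw [← hC₁, hs.mem_cellBoundary_iff] at h
          exact h (iff_of_false (fun h => hz.2 (hi₁ h)) fun h => hwF (hi₁ h))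
        · rw [← hC₂, hs.mem_cellBoundary_iff] at h
          exact h (iff_of_false (fun h => hz.2 (hi₂ h)) fun h => hwF (hi₂ h))
    · intro h
      obtain ⟨z, hz⟩ := hne₁
      have hzF := hi₁ hz
      exact (h ▸ hzF : z ∈ _ \ F).2 hzF
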